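/- arXiv:1304.4018 — 2 statements merged into one kernel-verified Lean document; each statement's English description precedes it below -/
import Mathlib

section
/- For every k ∈ ℕ and ℓ ∈ ℕ, the ℓ-fold composition (d/dx + x)^ℓ applied to the ℓ-fold composition (−d/dx + x)^ℓ applied to h_k equals 2^ℓ · (∏_{m=1}^{ℓ} (k+m)) · h_k. -/
open MeasureTheory Real

/-- The `m`-th physicists' Hermite polynomial
`P_m(u) = (−1)^m e^{u²} (d/du)^m e^{−u²}`. -/
noncomputable def hermitePoly (m : ℕ) (u : ℝ) : ℝ :=
  (-1) ^ m * Real.exp (u ^ 2) * iteratedDeriv m (fun v => Real.exp (-v ^ 2)) u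

/-- The `m`-th Hermite function `h_m(u) = (2^m m! √π)^{−1/2} P_m(u) e^{−u²/2}`. -/
noncomputable def hermiteFun (m : ℕ) (u : ℝ) : ℝ :=
  (Real.sqrt (2 ^ m * m.factorial * Real.sqrt Real.pi))⁻¹ * hermitePoly m u *
    Real.exp (-u ^ 2 / 2)

/-- The raising operator `A₊ f = −f' + x f`. -/
noncomputable def raiseOp (f : ℝ → ℝ) : ℝ → ℝ := fun x => -deriv f x + x * f x

/-- The lowering operator `A₋ f = f' + x f`. -/
noncomputable def lowerOp (f : ℝ → ℝ) : ℝ → ℝ := fun x => deriv f x + x * f x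

/-- The unnormalized Hermite function `(-1)^n e^{u²/2} (d/du)^n e^{-u²}`. -/
noncomputable def hermiteAux (n : ℕ) (u : ℝ) : ℝ :=
  (-1) ^ n * Real.exp (u ^ 2 / 2) * iteratedDeriv n (fun v => Real.exp (-v ^ 2)) u

theorem hermiteFun_eq_const_mul_hermiteAux (n : ℕ) :
    hermiteFun n = fun x =>
      (Real.sqrt (2 ^ n * n.factorial * Real.sqrt Real.pi))⁻¹ * hermiteAux n x := by
  funext x
  have h : Real.exp (x ^ 2) * Real.exp (-x ^ 2 / 2) = Real.exp (x ^ 2 / 2) := by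
    rw [← Real.exp_add]
    ring_nf
  simp only [hermiteFun, hermitePoly, hermiteAux, ← h]
  ring

theorem hasDerivAt_iteratedDeriv_exp_neg_sq (n : ℕ) (x : ℝ) :
    HasDerivAt (iteratedDeriv n (fun v : ℝ => Real.exp (-v ^ 2)))
      (iteratedDeriv (n + 1) (fun v : ℝ => Real.exp (-v ^ 2)) x) x := by
  have h : ContDiff ℝ (n + 1 : ℕ) (fun v : ℝ => Real.exp (-v ^ 2)) := by fun_prop
  rw [iteratedDeriv_succ]
  exact (h.differentiable_iteratedDeriv n (by exact_mod_cast n.lt_succ_self) x).hasDerivAt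

theorem iteratedDeriv_exp_neg_sq_add_two (n : ℕ) (x : ℝ) :
    iteratedDeriv (n + 2) (fun v : ℝ => Real.exp (-v ^ 2)) x =
      -2 * x * iteratedDeriv (n + 1) (fun v : ℝ => Real.exp (-v ^ 2)) x -
        2 * (n + 1) * iteratedDeriv n (fun v : ℝ => Real.exp (-v ^ 2)) x := by
  induction n generalizing x with
  | zero =>
    have h1 : iteratedDeriv 1 (fun v : ℝ => Real.exp (-v ^ 2)) =
        fun x => -2 * x * iteratedDeriv 0 (fun v : ℝ => Real.exp (-v ^ 2)) x := by
      funext y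
      rw [iteratedDeriv_one, iteratedDeriv_zero, (hasDerivAt_pow 2 y).fun_neg.exp.deriv]
      push_cast
      ring
    have h2 := ((hasDerivAt_id x).const_mul (-2)).mul (hasDerivAt_iteratedDeriv_exp_neg_sq 0 x)
    have h3 := hasDerivAt_iteratedDeriv_exp_neg_sq 1 x
    rw [h1] at h3
    rw [h3.unique h2]
    simp only [id, Nat.cast_zero]
    ring
  | succ n ih =>
    have h1 := funext ih
    have h2 := (((hasDerivAt_id x).const_mul (-2)).mul
      (hasDerivAt_iteratedDeriv_exp_neg_sq (n + 1) x)).sub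
        ((hasDerivAt_iteratedDeriv_exp_neg_sq n x).const_mul (2 * ((n : ℝ) + 1)))
    have h3 := hasDerivAt_iteratedDeriv_exp_neg_sq (n + 2) x
    rw [h1] at h3
    rw [show n + 1 + 2 = n + 2 + 1 from rfl, h3.unique h2]
    simp only [id, Nat.cast_succ]
    ring

theorem hasDerivAt_hermiteAux (n : ℕ) (x : ℝ) :
    HasDerivAt (hermiteAux n) (x * hermiteAux n x - hermiteAux (n + 1) x) x := by
  have h := ((((hasDerivAt_pow 2 x).div_const 2).exp.const_mul ((-1) ^ n)).mul
    (hasDerivAt_iteratedDeriv_exp_neg_sq n x))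
  refine h.congr_deriv ?_
  simp only [hermiteAux, pow_succ]
  push_cast
  ring

theorem raiseOp_const_mul_hermiteAux (c : ℝ) (n : ℕ) :
    raiseOp (fun x => c * hermiteAux n x) = fun x => c * hermiteAux (n + 1) x := by
  funext x
  simp only [raiseOp, ((hasDerivAt_hermiteAux n x).const_mul c).deriv]
  ring

theorem lowerOp_const_mul_hermiteAux (c : ℝ) (n : ℕ) :
    lowerOp (fun x => c * hermiteAux (n + 1) x) =
      fun x => c * (2 * (n + 1)) * hermiteAux n x := by
  funext x
  simp only [lowerOp, ((hasDerivAt_hermiteAux (n + 1) x).const_mul c).deriv]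
  simp only [hermiteAux]
  rw [iteratedDeriv_exp_neg_sq_add_two n x]
  ring

theorem raiseOp_iterate_const_mul_hermiteAux (c : ℝ) (k ℓ : ℕ) :
    raiseOp^[ℓ] (fun x => c * hermiteAux k x) = fun x => c * hermiteAux (k + ℓ) x := by
  induction ℓ with
  | zero => rfl
  | succ ℓ ih =>
    rw [Function.iterate_succ_apply', ih, raiseOp_const_mul_hermiteAux]
    rfl

theorem lowerOp_iterate_const_mul_hermiteAux (c : ℝ) (k ℓ : ℕ) :
    lowerOp^[ℓ] (fun x => c * hermiteAux (k + ℓ) x) =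
      fun x => c * (2 ^ ℓ * ∏ m ∈ Finset.Icc 1 ℓ, ((k : ℝ) + m)) * hermiteAux k x := by
  induction ℓ generalizing c with
  | zero => simp
  | succ ℓ ih =>
    rw [Function.iterate_succ_apply, ← add_assoc, lowerOp_const_mul_hermiteAux, ih,
      Finset.prod_Icc_succ_top (Nat.le_add_left 1 ℓ)]
    funext x
    push_cast
    ring

/-- `(d/dx + x)^ℓ (−d/dx + x)^ℓ h_k = 2^ℓ (∏_{m=1}^{ℓ} (k+m)) h_k`. -/
theorem hermiteFun_lower_raise (k ℓ : ℕ) :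
    lowerOp^[ℓ] (raiseOp^[ℓ] (hermiteFun k)) =
      fun x => 2 ^ ℓ * (∏ m ∈ Finset.Icc 1 ℓ, ((k : ℝ) + m)) * hermiteFun k x := by
  rw [hermiteFun_eq_const_mul_hermiteAux, raiseOp_iterate_const_mul_hermiteAux,
    lowerOp_iterate_const_mul_hermiteAux]
  funext x
  ring
end

section
/- For every t > 0 and x, y ∈ ℝ, the one-dimensional Hermite heat (Mehler) kernel satisfies the Gaussian bound W_t^H(x,y) ≤ (2πt)^{−1/2} e^{−(x−y)²/(4t)}. -/
open MeasureTheory Real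

/-- The one-dimensional Hermite heat (Mehler) kernel `W_t^H(x,y)`. -/
noncomputable def heatKernel (t x y : ℝ) : ℝ :=
  (Real.sqrt Real.pi)⁻¹ * Real.sqrt (Real.exp (-2 * t) / (1 - Real.exp (-4 * t))) *
    Real.exp (-(1 / 4) * ((x - y) ^ 2 * (1 + Real.exp (-2 * t)) / (1 - Real.exp (-2 * t)) +
      (x + y) ^ 2 * (1 - Real.exp (-2 * t)) / (1 + Real.exp (-2 * t))))

/-- The elementary inequality `tanh t ≤ t`, written in terms of `exp (-2 * t)`. -/
lemma one_sub_exp_neg_two_mul_le {t : ℝ} (ht : 0 ≤ t) :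
    1 - exp (-2 * t) ≤ t * (1 + exp (-2 * t)) := by
  have hlog := le_log_one_add_of_nonneg (sub_nonneg.2 (one_le_exp (by linarith : 0 ≤ 2 * t)))
  rw [add_sub_cancel, log_exp, div_le_iff₀ (by linarith [exp_pos (2 * t)])] at hlog
  have hmul : exp (-2 * t) * exp (2 * t) = 1 := by rw [← exp_add]; simp
  nlinarith [mul_le_mul_of_nonneg_left hlog (exp_pos (-2 * t)).le]

lemma two_mul_mul_exp_neg_two_mul_le {t : ℝ} (ht : 0 ≤ t) :
    2 * t * exp (-2 * t) ≤ 1 - exp (-4 * t) := by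
  have hsq : exp (-4 * t) = exp (-2 * t) * exp (-2 * t) := by rw [← exp_add]; ring_nf
  have hle : exp (-2 * t) ≤ 1 := exp_le_one_iff.2 (by linarith)
  have hmul : exp (-2 * t) * exp (2 * t) = 1 := by rw [← exp_add]; simp
  nlinarith [mul_le_mul_of_nonneg_left (add_one_le_exp (2 * t)) (exp_pos (-2 * t)).le,
    mul_nonneg (exp_pos (-2 * t)).le (sub_nonneg.2 hle)]

/-- The Gaussian bound for the Mehler kernel:
`W_t^H(x,y) ≤ (2πt)^{−1/2} e^{−(x−y)²/(4t)}`. -/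
theorem heatKernel_gaussian_bound (t x y : ℝ) (ht : 0 < t) :
    heatKernel t x y ≤
      (Real.sqrt (2 * Real.pi * t))⁻¹ * Real.exp (-(x - y) ^ 2 / (4 * t)) := by
  have hq : exp (-2 * t) < 1 := exp_lt_one_iff.2 (by linarith)
  have hq4 : exp (-4 * t) < 1 := exp_lt_one_iff.2 (by linarith)
  have hq0 := exp_pos (-2 * t)
  have hfactor : (√π)⁻¹ * √(exp (-2 * t) / (1 - exp (-4 * t))) ≤ (√(2 * π * t))⁻¹ := by
    rw [← sqrt_inv, ← sqrt_inv, ← sqrt_mul (inv_nonneg.2 pi_pos.le)]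
    apply sqrt_le_sqrt
    rw [show (2 * π * t)⁻¹ = π⁻¹ * (1 / (2 * t)) by field_simp]
    refine mul_le_mul_of_nonneg_left ?_ (inv_nonneg.2 pi_pos.le)
    rw [div_le_div_iff₀ (by linarith) (by linarith)]
    linarith [two_mul_mul_exp_neg_two_mul_le ht.le]
  have hcoth : (x - y) ^ 2 / t ≤ (x - y) ^ 2 * (1 + exp (-2 * t)) / (1 - exp (-2 * t)) := by
    rw [div_le_div_iff₀ ht (by linarith), mul_assoc]
    gcongr
    linarith [one_sub_exp_neg_two_mul_le ht.le]
  have htanh : 0 ≤ (x + y) ^ 2 * (1 - exp (-2 * t)) / (1 + exp (-2 * t)) :=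
    div_nonneg (mul_nonneg (sq_nonneg _) (by linarith)) (by linarith)
  have hexponent : -(x - y) ^ 2 / (4 * t) = -(1 / 4) * ((x - y) ^ 2 / t) := by ring
  unfold heatKernel
  refine mul_le_mul hfactor (exp_le_exp.2 ?_) (exp_pos _).le (by positivity)
  rw [hexponent]
  linarith
end
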